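/- Let Γ ⊂ P^n, n ≥ 2, be a finite subscheme of degree d ≥ 4n² + 6n + 1 in linearly general position over an algebraically closed field of characteristic 0, and write d = nq + r + 2 with 0 ≤ r ≤ n−1. Then h¹(P^n, I_Γ(q)) ≤ r + 1. -/

import Mathlib

open MvPolynomial Filter
open scoped Classical

attribute [local instance] MvPolynomial.gradedAlgebra

noncomputable section

variable {K : Type} [Field K] {n : ℕ}

/-- The Hilbert function, in degree `m`, of the quotient of the homogeneous
coordinate ring of `ℙ^n_K` by the ideal `I`. -/
def hilbF (I : Ideal (MvPolynomial (Fin (n+1)) K)) (m : ℕ) : ℕ :=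
  Module.finrank K
    ((MvPolynomial.homogeneousSubmodule (Fin (n+1)) K m).map
      (Ideal.Quotient.mkₐ K I).toLinearMap)

/-- The irrelevant maximal ideal `(x_0, …, x_n)`. -/
def irrelevantIdeal (K : Type) [Field K] (n : ℕ) : Ideal (MvPolynomial (Fin (n+1)) K) :=
  Ideal.span (Set.range MvPolynomial.X)

/-- Saturation of a homogeneous ideal with respect to the irrelevant ideal. -/
def saturate (I : Ideal (MvPolynomial (Fin (n+1)) K)) : Ideal (MvPolynomial (Fin (n+1)) K) :=
  ⨆ k : ℕ, Submodule.colon I ((irrelevantIdeal K n ^ k : Ideal (MvPolynomial (Fin (n+1)) K)) : Submodule (MvPolynomial (Fin (n+1)) K) (MvPolynomial (Fin (n+1)) K))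

/-- `I` is the (saturated, homogeneous) ideal of a nonempty finite closed subscheme of
`ℙ^n`, i.e. its Hilbert function is eventually a positive constant. -/
structure IsFiniteSubscheme (I : Ideal (MvPolynomial (Fin (n+1)) K)) : Prop where
  homog : Ideal.IsHomogeneous (MvPolynomial.homogeneousSubmodule (Fin (n+1)) K) I
  saturated : saturate I = I
  finite : ∃ d : ℕ, 0 < d ∧ ∀ᶠ m : ℕ in atTop, hilbF I m = d

/-- The degree (length) of the finite scheme with ideal `I` : the eventual value of
its Hilbert function. -/
def schemeDeg (I : Ideal (MvPolynomial (Fin (n+1)) K)) : ℕ :=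
  if h : ∃ d : ℕ, ∀ᶠ m : ℕ in atTop, hilbF I m = d then h.choose else 0

/-- The Castelnuovo–Mumford regularity of the finite scheme with ideal `I` : the least
`p ≥ 1` such that the scheme is `(p-1)`-normal (for a finite scheme, `p`-regularity is
equivalent to `(p-1)`-normality). -/
def schemeReg (I : Ideal (MvPolynomial (Fin (n+1)) K)) : ℕ :=
  sInf {p : ℕ | 1 ≤ p ∧ ∀ m : ℕ, p - 1 ≤ m → hilbF I m = schemeDeg I}

/-- `h¹(ℙ^n, I_Γ(q))` for a finite scheme `Γ` and `q ≥ 0`: the failure of `q`-normality,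
`deg Γ - h_Γ(q)`. -/
def h1F (I : Ideal (MvPolynomial (Fin (n+1)) K)) (q : ℕ) : ℕ :=
  schemeDeg I - hilbF I q

/-- `J` is the ideal of a `t`-dimensional linear subspace of `ℙ^n`: it is generated by a
space of linear forms of codimension... i.e. of `K`-dimension `n - t`. -/
def IsLinearSubspace (J : Ideal (MvPolynomial (Fin (n+1)) K)) (t : ℕ) : Prop :=
  ∃ W : Submodule K (MvPolynomial (Fin (n+1)) K),
    W ≤ MvPolynomial.homogeneousSubmodule (Fin (n+1)) K 1 ∧
    Module.finrank K W + t = n ∧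
    J = Ideal.span (W : Set (MvPolynomial (Fin (n+1)) K))

/-- The ideal of the scheme-theoretic intersection (defined by the sum of the ideal
sheaves): the saturation of `I + J`. -/
def interIdeal (I J : Ideal (MvPolynomial (Fin (n+1)) K)) : Ideal (MvPolynomial (Fin (n+1)) K) :=
  saturate (I ⊔ J)

/-- The residual scheme `Γ : V`, where `V` is the hypersurface `{f = 0}`, is defined by
the colon ideal `(I_Γ : f)`. -/
def residualIdeal (I : Ideal (MvPolynomial (Fin (n+1)) K)) (f : MvPolynomial (Fin (n+1)) K) :
    Ideal (MvPolynomial (Fin (n+1)) K) :=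
  Submodule.colon I (Ideal.span {f})

/-- `Γ` admits a `(t+2)`-secant `t`-plane. -/
def HasSecantPlane (I : Ideal (MvPolynomial (Fin (n+1)) K)) (t : ℕ) : Prop :=
  ∃ J : Ideal (MvPolynomial (Fin (n+1)) K),
    IsLinearSubspace J t ∧ t + 2 ≤ schemeDeg (interIdeal I J)

/-- `t(Γ)`: the smallest `t` such that `Γ` admits a `(t+2)`-secant `t`-plane. -/
def tInv (I : Ideal (MvPolynomial (Fin (n+1)) K)) : ℕ :=
  sInf {t : ℕ | HasSecantPlane I t}

/-- `Γ` is in linearly general position if `t(Γ) = n`. -/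
def InLinGenPos (I : Ideal (MvPolynomial (Fin (n+1)) K)) : Prop :=
  tInv I = n

/-- `Γ ⊆ ℙ^n` is nondegenerate: `I(Γ)` contains no nonzero linear form. -/
def NondegenerateScheme (I : Ideal (MvPolynomial (Fin (n+1)) K)) : Prop :=
  Submodule.restrictScalars K I ⊓ MvPolynomial.homogeneousSubmodule (Fin (n+1)) K 1 = ⊥

/-- The (projective) dimension of the linear span `⟨Γ⟩` of the scheme with ideal `I`:
`n` minus the number of independent linear forms in `I`. -/
def spanDim (I : Ideal (MvPolynomial (Fin (n+1)) K)) : ℕ :=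
  n - Module.finrank K
    ↥(Submodule.restrictScalars K I ⊓ MvPolynomial.homogeneousSubmodule (Fin (n+1)) K 1)

/-- `Γ ∩ Λ` is nondegenerate as a subscheme of the `t`-plane `Λ`: it is contained in no
`(t-1)`-dimensional linear subspace of `Λ`. -/
def NondegenerateIn (I Λ : Ideal (MvPolynomial (Fin (n+1)) K)) (t : ℕ) : Prop :=
  ∀ J : Ideal (MvPolynomial (Fin (n+1)) K),
    IsLinearSubspace J (t - 1) → Λ ≤ J → ¬ J ≤ interIdeal I Λ

/-- `Γ ∩ Λ` is in linearly general position as a subscheme of the `t`-plane `Λ`: it has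
no `(s+2)`-secant `s`-plane inside `Λ` for any `s < t`. -/
def InLinGenPosIn (I Λ : Ideal (MvPolynomial (Fin (n+1)) K)) (t : ℕ) : Prop :=
  ∀ s : ℕ, s < t → ∀ J : Ideal (MvPolynomial (Fin (n+1)) K),
    IsLinearSubspace J s → Λ ≤ J → schemeDeg (interIdeal I J) ≤ s + 1

/-- `J` is the (saturated) homogeneous ideal of a rational normal curve of degree `t`
in `ℙ^n` : the curve is the image of `ℙ^1` under a parametrization by a basis-spanning
family of binary forms of degree `t`, and `J` is the vanishing ideal of (the affine cone
over) this image. -/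
def IsRNC (t : ℕ) (J : Ideal (MvPolynomial (Fin (n+1)) K)) : Prop :=
  ∃ p : Fin (n+1) → MvPolynomial (Fin 2) K,
    (∀ i, (p i).IsHomogeneous t) ∧
    Submodule.span K (Set.range p) = MvPolynomial.homogeneousSubmodule (Fin 2) K t ∧
    J = ⨅ x : Fin 2 → K,
      RingHom.ker (MvPolynomial.eval (fun i => MvPolynomial.eval x (p i)) :
        MvPolynomial (Fin (n+1)) K →+* K)

/-- `ρ(Γ)`: the maximal length of the intersection of `Γ` with a rational normal curve
(of degree `n`) in `ℙ^n`. -/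
def rhoInv (I : Ideal (MvPolynomial (Fin (n+1)) K)) : ℕ :=
  sSup {e : ℕ | ∃ J : Ideal (MvPolynomial (Fin (n+1)) K),
    IsRNC n J ∧ e = schemeDeg (interIdeal I J)}

/-- The (saturated homogeneous) vanishing ideal of a point of `ℙ^n`. -/
def pointIdeal (P : Projectivization K (Fin (n+1) → K)) : Ideal (MvPolynomial (Fin (n+1)) K) :=
  ⨅ c : K, RingHom.ker
    (MvPolynomial.eval (c • P.rep) : MvPolynomial (Fin (n+1)) K →+* K)

/-- The vanishing ideal of a finite set of points of `ℙ^n`. -/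
def idealOfFinset (S : Finset (Projectivization K (Fin (n+1) → K))) :
    Ideal (MvPolynomial (Fin (n+1)) K) :=
  ⨅ P ∈ S, pointIdeal P

/-- A finite set of points of `ℙ^n` is in uniform position if every subset `Y` has
Hilbert function `h_Y(ℓ) = min {|Y|, h_Γ(ℓ)}`. -/
def UniformPosition (S : Finset (Projectivization K (Fin (n+1) → K))) : Prop :=
  ∀ Y ⊆ S, ∀ ℓ : ℕ, hilbF (idealOfFinset Y) ℓ = min Y.card (hilbF (idealOfFinset S) ℓ)

end

open Module

theorem exists_ideal_finrank_eq (K : Type*) {A : Type*} [Field K] [IsAlgClosed K] [CommRing A]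
    [Algebra K A] [FiniteDimensional K A] (c : ℕ) (hc : c ≤ finrank K A) :
    ∃ J : Ideal A, finrank K J = c := by
  induction c with
  | zero => exact ⟨⊥, by
      have : Subsingleton (⊥ : Ideal A) := inferInstance
      exact finrank_zero_of_subsingleton⟩
  | succ c ih =>
    obtain ⟨J, hJ⟩ := ih (by omega)
    have : IsArtinianRing A := IsArtinianRing.of_finite K A
    have hne : J < ⊤ := lt_top_iff_ne_top.2 fun h ↦ by
      subst h
      have : finrank K (⊤ : Ideal A) = finrank K A :=
        LinearEquiv.finrank_eq ((Submodule.topEquiv (R := A) (M := A)).restrictScalars K)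
      omega
    obtain ⟨J', hcov, -⟩ := exists_covBy_le_of_lt hne
    refine ⟨J', ?_⟩
    have hs := (covBy_iff_quot_is_simple hcov.le).1 hcov
    obtain ⟨m, hm, ⟨e⟩⟩ := isSimpleModule_iff_quot_maximal.1 hs
    let := Ideal.Quotient.field m
    have h1 : finrank K (A ⧸ m) = 1 := by
      have hb := IsAlgClosed.algebraMap_bijective_of_isIntegral (k := K) (K := A ⧸ m)
      rw [← (LinearEquiv.ofBijective (Algebra.linearMap K (A ⧸ m)) hb).finrank_eq]
      exact finrank_self K
    have h2 := (e.restrictScalars K).finrank_eq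
    have h3 := Submodule.finrank_quotient_add_finrank
      ((Submodule.comap J'.subtype J).restrictScalars K)
    have h4 := ((Submodule.comapSubtypeEquivOfLe hcov.le).restrictScalars K).finrank_eq
    have h5 : finrank K (J' ⧸ (Submodule.comap J'.subtype J).restrictScalars K) =
      finrank K (J' ⧸ (Submodule.comap J'.subtype J)) := 
      (Submodule.Quotient.restrictScalarsEquiv K _).finrank_eq
    have h6 : finrank K ((Submodule.comap J'.subtype J).restrictScalars K) =
      finrank K (Submodule.comap J'.subtype J) := rfl
    omega

theorem finrank_pow_range_ge (K : Type*) {V : Type*} [Field K] [IsAlgClosed K] [AddCommGroup V]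
    [Module K V] [FiniteDimensional K V] {n : ℕ} (hV : finrank K V = n + 1) (q : ℕ) :
    ∀ {A : Type*} [CommRing A] [Algebra K A] [FiniteDimensional K A] (l : V →ₗ[K] A),
      1 ∈ LinearMap.range l →
      (∀ W : Submodule K V, 1 ≤ finrank K W → finrank K W ≤ n →
        finrank K (A ⧸ Ideal.span (W.map l : Set A)) + finrank K W ≤ n + 1) →
      n * q + 1 ≤ finrank K A →
      n * q + 1 ≤ finrank K ((LinearMap.range l) ^ q : Submodule K A) := by
  have key : ∀ {A : Type _} [CommRing A] [Algebra K A] [FiniteDimensional K A]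
      (L : Submodule K A) (m : ℕ), 1 ∈ L → 1 ≤ finrank K A →
      1 ≤ finrank K (L ^ m : Submodule K A) := by
    intro A _ _ _ L m h1 hA
    have : Nontrivial A := nontrivial_of_finrank_pos (R := K) hA
    have h1m : (1 : A) ∈ L ^ m := by simpa using Submodule.pow_mem_pow L h1 m
    have : Nontrivial (L ^ m : Submodule K A) := ⟨⟨1, h1m⟩, 0, by simp⟩
    exact finrank_pos
  induction q with
  | zero =>
    intro A _ _ _ l h1 _ hq
    simpa using key (LinearMap.range l) 0 h1 (by simpa using hq)
  | succ q ih =>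
    intro A _ _ _ l h1 hl hq
    rcases Nat.eq_zero_or_pos n with rfl | hn
    · simpa using key (LinearMap.range l) (q + 1) h1 (by simpa using hq)
    set L := LinearMap.range l with hL
    rw [mul_add, mul_one] at hq ⊢
    obtain ⟨J, hJ⟩ := exists_ideal_finrank_eq K (finrank K A - n) (Nat.sub_le _ _)
    have hJn : finrank K (A ⧸ J) = n := by
      rw [Submodule.finrank_quotient, hJ]; omega
    let π : A →ₗ[K] A ⧸ J := (Ideal.Quotient.mkₐ K J).toLinearMap
    have hπ : ∀ x, π x = 0 ↔ x ∈ J := fun x ↦ Ideal.Quotient.eq_zero_iff_mem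
    let g := π ∘ₗ l
    let N := LinearMap.ker g
    have hN := LinearMap.finrank_range_add_finrank_ker g
    have hr := Submodule.finrank_le (LinearMap.range g)
    have hPJ : Ideal.span (N.map l : Set A) ≤ J := by
      rw [Ideal.span_le]
      rintro _ ⟨v, hv, rfl⟩
      exact (hπ _).1 hv
    have hPn : finrank K (Ideal.span (N.map l : Set A)) ≤ finrank K J :=
      Submodule.finrank_mono (s := (Ideal.span (N.map l : Set A)).restrictScalars K)
        (t := J.restrictScalars K) hPJ
    have hPq : finrank K (A ⧸ Ideal.span (N.map l : Set A)) =
      finrank K A - finrank K (Ideal.span (N.map l : Set A)) := Submodule.finrank_quotient _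
    have hNn : finrank K N ≤ n := by
      by_contra hcon
      have hr0 : finrank K (LinearMap.range g) = 0 := by
        change _ + finrank K N = _ at hN
        omega
      rw [Submodule.finrank_eq_zero, LinearMap.range_eq_bot] at hr0
      obtain ⟨v, hv⟩ := h1
      have : π 1 = 0 := by
        rw [← hv]
        exact LinearMap.congr_fun hr0 v
      rw [hπ, ← Ideal.eq_top_iff_one] at this
      subst this
      have : finrank K (A ⧸ (⊤ : Ideal A)) = 0 := finrank_zero_of_subsingleton
      omega
    change _ + finrank K N = _ at hN
    have hlN := hl N (by omega) hNn
    have hN1 : finrank K N = 1 := by omega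
    have hPJeq : Ideal.span (N.map l : Set A) = J := by
      have := Submodule.eq_of_le_of_finrank_le
        (S₁ := (Ideal.span (N.map l : Set A)).restrictScalars K)
        (S₂ := J.restrictScalars K) hPJ (by
          change finrank K J ≤ finrank K (Ideal.span (N.map l : Set A))
          omega)
      exact Submodule.restrictScalars_injective K _ _ this
    obtain ⟨v, -, hv⟩ := finrank_eq_one_iff'.1 hN1
    let T : A →ₗ[A] A := LinearMap.toSpanSingleton A A (l v)
    have hTr : LinearMap.range T = J := by
      rw [LinearMap.range_toSpanSingleton, ← hPJeq]
      apply le_antisymm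
      · rw [Submodule.span_singleton_le_iff_mem]
        exact Ideal.subset_span ⟨v, v.2, rfl⟩
      · rw [Ideal.span_le]
        rintro _ ⟨w, hw, rfl⟩
        obtain ⟨c, hc⟩ := hv ⟨w, hw⟩
        have hc' : w = c • (v : V) := by rw [← Submodule.coe_smul, hc]
        rw [hc', map_smul, Algebra.smul_def]
        exact Ideal.mul_mem_left _ _ (Ideal.mem_span_singleton_self _)
    let B := A ⧸ LinearMap.ker T
    have hB : finrank K B = finrank K J := by
      rw [← hTr]
      exact (T.quotKerEquivRange.restrictScalars K).finrank_eq
    let mk : A →ₐ[K] B := Ideal.Quotient.mkₐ K (LinearMap.ker T)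
    have hmk : Function.Surjective mk := Ideal.Quotient.mk_surjective
    have hrange : LinearMap.range (mk.toLinearMap ∘ₗ l) = L.map mk.toLinearMap :=
      LinearMap.range_comp _ _
    have hIH := ih (A := B) (mk.toLinearMap ∘ₗ l)
      (by
        obtain ⟨u, hu⟩ := h1
        exact ⟨u, by simp [hu]⟩)
      (by
        intro W hW1 hWn
        refine le_trans (Nat.add_le_add_right ?_ _) (hl W hW1 hWn)
        have hle : Ideal.span (W.map l : Set A) ≤
            (Ideal.span (W.map (mk.toLinearMap ∘ₗ l) : Set B)).comap mk := by
          rw [Ideal.span_le]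
          rintro _ ⟨w, hw, rfl⟩
          exact Ideal.subset_span ⟨w, hw, rfl⟩
        exact LinearMap.finrank_le_finrank_of_surjective
          (f := (Ideal.quotientMapₐ _ mk hle).toLinearMap)
          (Ideal.quotientMap_surjective (H := hle) hmk))
      (by omega)
    have hmp : L.map mk.toLinearMap ^ q = (L ^ q).map mk.toLinearMap :=
      (Submodule.map_pow L mk q).symm
    rw [hrange, hmp] at hIH
    let ι : B →ₗ[K] A := ((LinearMap.ker T).liftQ T le_rfl).restrictScalars K
    have hι : Function.Injective ((LinearMap.ker T).liftQ T le_rfl) :=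
      LinearMap.ker_eq_bot.1 (Submodule.ker_liftQ_eq_bot' _ T rfl)
    replace hι : Function.Injective ι := hι
    have hιr := (Submodule.equivMapOfInjective ι hι ((L ^ q).map mk.toLinearMap)).finrank_eq
    have hsub : ((L ^ q).map mk.toLinearMap).map ι ≤ L ^ (q + 1) ⊓ LinearMap.ker π := by
      rintro _ ⟨_, ⟨y, hy, rfl⟩, rfl⟩
      have : ι (mk.toLinearMap y) = y * l v := rfl
      rw [this]
      refine ⟨?_, ?_⟩
      · rw [SetLike.mem_coe, pow_succ]
        exact Submodule.mul_mem_mul hy ⟨v, rfl⟩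
      · exact (hπ _).2 (J.mul_mem_left _ ((hπ _).1 v.2))
    have hsub' := Submodule.finrank_mono hsub
    have hmap : (L ^ (q + 1)).map π = ⊤ := by
      have : LinearMap.range g = ⊤ := Submodule.eq_top_of_finrank_eq (by omega)
      rw [eq_top_iff, ← this, LinearMap.range_comp]
      apply Submodule.map_mono
      intro x hx
      rw [pow_succ]
      simpa using Submodule.mul_mem_mul (Submodule.pow_mem_pow L h1 q) hx
    have hrn := LinearMap.finrank_range_add_finrank_ker (π.domRestrict (L ^ (q + 1)))
    rw [LinearMap.range_domRestrict, hmap, finrank_top, LinearMap.ker_domRestrict] at hrn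
    have hk := (Submodule.equivMapOfInjective (L ^ (q + 1)).subtype
      (Submodule.subtype_injective _)
      ((LinearMap.ker π).comap (L ^ (q + 1)).subtype)).finrank_eq
    rw [Submodule.map_comap_subtype] at hk
    change _ + finrank K ((LinearMap.ker π).comap (L ^ (q + 1)).subtype) = _ at hrn
    omega

section HilbertFunction

variable {K : Type} [Field K] {n : ℕ}

theorem mem_saturate_iff {I : Ideal (MvPolynomial (Fin (n+1)) K)}
    {g : MvPolynomial (Fin (n+1)) K} :
    g ∈ saturate I ↔ ∃ k, ∀ a ∈ irrelevantIdeal K n ^ k, g * a ∈ I := by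
  have hmono : Monotone fun k : ℕ ↦ Submodule.colon I
      ((irrelevantIdeal K n ^ k : Ideal (MvPolynomial (Fin (n+1)) K)) :
        Set (MvPolynomial (Fin (n+1)) K)) := by
    intro a b hab
    exact Submodule.colon_mono le_rfl (Ideal.pow_le_pow_right hab)
  rw [saturate]
  erw [Submodule.mem_iSup_of_directed _ hmono.directed_le]
  simp only [Submodule.mem_colon, smul_eq_mul]
  rfl

theorem le_saturate (I : Ideal (MvPolynomial (Fin (n+1)) K)) : I ≤ saturate I :=
  fun _ hg ↦ mem_saturate_iff.2 ⟨0, fun _ _ ↦ I.mul_mem_right _ hg⟩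

theorem mem_saturate_of_forall_X_mul_mem {I : Ideal (MvPolynomial (Fin (n+1)) K)}
    {g : MvPolynomial (Fin (n+1)) K} (h : ∀ i, X i * g ∈ saturate I) : g ∈ saturate I := by
  choose k hk using fun i ↦ mem_saturate_iff.1 (h i)
  refine mem_saturate_iff.2 ⟨Finset.univ.sup k + 1, fun a ha ↦ ?_⟩
  rw [pow_succ] at ha
  refine Submodule.mul_induction_on ha (fun b hb c hc ↦ ?_) fun b c hb hc ↦ by
    rw [mul_add]; exact I.add_mem hb hc
  refine Submodule.span_induction (p := fun c _ ↦ g * (b * c) ∈ I) ?_ (by simp)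
    (fun u v _ _ hu hv ↦ by rw [mul_add, mul_add]; exact I.add_mem hu hv)
    (fun u v _ hv ↦ by
      have : g * (b * (u • v)) = u * (g * (b * v)) := by rw [smul_eq_mul]; ring
      rw [this]
      exact I.mul_mem_left _ hv) hc
  rintro _ ⟨i, rfl⟩
  have := hk i b (Ideal.pow_le_pow_right (Finset.le_sup (Finset.mem_univ i)) hb)
  rwa [show g * (b * X i) = X i * g * b by ring]

theorem exists_linear_form_regular_mod_saturate [Infinite K]
    (I : Ideal (MvPolynomial (Fin (n+1)) K)) :
    ∃ x ∈ homogeneousSubmodule (Fin (n+1)) K 1, ∀ g, x * g ∈ saturate I → g ∈ saturate I := by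
  let R := MvPolynomial (Fin (n+1)) K
  let M := R ⧸ saturate I
  let V := homogeneousSubmodule (Fin (n+1)) K 1
  have hfin := associatedPrimes.finite R M
  let F : Ideal R → Submodule K V := fun P ↦ (P.restrictScalars K).comap V.subtype
  have htop : (⊤ : Submodule K V) ∉ F '' associatedPrimes R M := by
    rintro ⟨P, hP, hPt⟩
    obtain ⟨hPp, y, hy⟩ := isAssociatedPrime_iff.1 hP
    obtain ⟨g, rfl⟩ := Ideal.Quotient.mk_surjective y
    have hmem : ∀ a, a ∈ P ↔ a * g ∈ saturate I := by
      intro a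
      rw [hy, Submodule.mem_colon_singleton, Submodule.mem_bot, ← Ideal.Quotient.eq_zero_iff_mem]
      rfl
    have hg : g ∈ saturate I := mem_saturate_of_forall_X_mul_mem fun i ↦ by
      rw [← hmem]
      have : (⟨X i, isHomogeneous_X K i⟩ : V) ∈ F P := hPt ▸ Submodule.mem_top
      exact this
    exact hPp.ne_top ((Ideal.eq_top_iff_one _).2 ((hmem 1).2 (by rwa [one_mul])))
  have hne := Subspace.biUnion_ne_univ_of_top_notMem (s := (hfin.image F).toFinset)
    (by simpa using htop)
  obtain ⟨x, hx⟩ := (Set.ne_univ_iff_exists_notMem _).1 hne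
  refine ⟨x, x.2, fun g hg ↦ ?_⟩
  by_contra hcon
  have hz : (x : R) ∈ ⋃ p ∈ associatedPrimes R M, (p : Set R) := by
    rw [biUnion_associatedPrimes_eq_zero_divisors]
    refine ⟨Ideal.Quotient.mk _ g, fun h ↦ hcon (Ideal.Quotient.eq_zero_iff_mem.1 h), ?_⟩
    exact Ideal.Quotient.eq_zero_iff_mem.2 hg
  apply hx
  simp only [Set.mem_iUnion, Set.Finite.mem_toFinset] at hz ⊢
  obtain ⟨P, hP, hxP⟩ := hz
  exact ⟨F P, ⟨P, hP, rfl⟩, hxP⟩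

instance finiteDimensional_homogeneousSubmodule (m : ℕ) :
    FiniteDimensional K (homogeneousSubmodule (Fin (n+1)) K m) :=
  Module.Finite.iff_fg.2 (homogeneousSubmodule_fg (Fin (n+1)) K m)

theorem hilbF_anti {I J : Ideal (MvPolynomial (Fin (n+1)) K)} (h : I ≤ J) (m : ℕ) :
    hilbF J m ≤ hilbF I m := by
  have : (homogeneousSubmodule (Fin (n+1)) K m).map (Ideal.Quotient.mkₐ K J).toLinearMap =
      ((homogeneousSubmodule (Fin (n+1)) K m).map (Ideal.Quotient.mkₐ K I).toLinearMap).map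
        (Ideal.Quotient.factorₐ K h).toLinearMap := by
    rw [← Submodule.map_comp]
    rfl
  rw [hilbF, this]
  exact Submodule.finrank_map_le _ _

theorem hilbF_saturate_mono [Infinite K] (I : Ideal (MvPolynomial (Fin (n+1)) K)) :
    Monotone (hilbF (saturate I)) := by
  obtain ⟨x, hx, hreg⟩ := exists_linear_form_regular_mod_saturate I
  refine monotone_nat_of_le_succ fun m ↦ ?_
  let T := LinearMap.mulLeft K (Ideal.Quotient.mk (saturate I) x)
  have hT : Function.Injective T := by
    rw [← LinearMap.ker_eq_bot, LinearMap.ker_eq_bot']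
    intro y hy
    obtain ⟨g, rfl⟩ := Ideal.Quotient.mk_surjective y
    exact Ideal.Quotient.eq_zero_iff_mem.2 (hreg g (Ideal.Quotient.eq_zero_iff_mem.1 hy))
  rw [hilbF, (Submodule.equivMapOfInjective T hT _).finrank_eq]
  refine Submodule.finrank_mono ?_
  rintro _ ⟨_, ⟨g, hg, rfl⟩, rfl⟩
  refine ⟨x * g, ?_, map_mul (Ideal.Quotient.mk (saturate I)) x g⟩
  rw [mul_comm]
  exact IsHomogeneous.mul hg hx

theorem schemeDeg_eq_of_eventually {I : Ideal (MvPolynomial (Fin (n+1)) K)} {e : ℕ}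
    (h : ∀ᶠ m in atTop, hilbF I m = e) : schemeDeg I = e := by
  have hex : ∃ d : ℕ, ∀ᶠ m : ℕ in atTop, hilbF I m = d := ⟨e, h⟩
  rw [schemeDeg, dif_pos hex]
  obtain ⟨m, h1, h2⟩ := (hex.choose_spec.and h).exists
  exact h1.symm.trans h2

theorem hilbF_saturate_eventually_eq_schemeDeg [Infinite K]
    (I : Ideal (MvPolynomial (Fin (n+1)) K)) {b : ℕ} (hb : ∀ m, hilbF (saturate I) m ≤ b) :
    ∀ᶠ m in atTop, hilbF (saturate I) m = schemeDeg (saturate I) := by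
  have hbdd : BddAbove (Set.range (hilbF (saturate I))) := ⟨b, by rintro _ ⟨m, rfl⟩; exact hb m⟩
  obtain ⟨M, hM⟩ := Nat.sSup_mem (Set.range_nonempty (hilbF (saturate I))) hbdd
  have h : ∀ᶠ m in atTop, hilbF (saturate I) m = hilbF (saturate I) M := by
    filter_upwards [eventually_ge_atTop M] with m hm
    exact le_antisymm (hM ▸ le_csSup hbdd ⟨m, rfl⟩) (hilbF_saturate_mono I hm)
  rwa [schemeDeg_eq_of_eventually h]

theorem aeval_mul_right_of_isHomogeneous {σ A : Type*} [CommRing A] [Algebra K A] (c : σ → A)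
    (u : A) {g : MvPolynomial σ K} {m : ℕ} (hg : g.IsHomogeneous m) :
    aeval (fun i ↦ c i * u) g = aeval c g * u ^ m := by
  rw [aeval_def, aeval_def, eval₂_eq, eval₂_eq, Finset.sum_mul]
  refine Finset.sum_congr rfl fun e he ↦ ?_
  rw [hg.degree_eq_sum_deg_support he, mul_assoc, ← Finset.prod_pow_eq_pow_sum,
    ← Finset.prod_mul_distrib]
  simp only [mul_pow]

theorem exists_algHom_finrank_map_eq_hilbF {I : Ideal (MvPolynomial (Fin (n+1)) K)}
    (hI : I.IsHomogeneous (homogeneousSubmodule (Fin (n+1)) K))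
    {x : MvPolynomial (Fin (n+1)) K} (hx : x ∈ homogeneousSubmodule (Fin (n+1)) K 1)
    (hreg : ∀ g, x * g ∈ I → g ∈ I) :
    ∃ (B : Type) (_ : CommRing B) (_ : Algebra K B) (φ : MvPolynomial (Fin (n+1)) K →ₐ[K] B),
      φ x = 1 ∧ (∀ g ∈ I, φ g = 0) ∧
      ∀ m, finrank K ((homogeneousSubmodule (Fin (n+1)) K m).map φ.toLinearMap) = hilbF I m := by
  let R := MvPolynomial (Fin (n+1)) K ⧸ I
  let y : R := Ideal.Quotient.mk I x
  let B := Localization.Away y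
  let π : MvPolynomial (Fin (n+1)) K →ₐ[K] R := Ideal.Quotient.mkₐ K I
  let ι : R →ₐ[K] B := IsScalarTower.toAlgHom K R B
  let u : B := IsLocalization.Away.invSelf y
  have hyu : ι y * u = 1 := IsLocalization.Away.mul_invSelf y
  let φ : MvPolynomial (Fin (n+1)) K →ₐ[K] B := aeval fun i ↦ (ι.comp π) (X i) * u
  have hφ : ∀ {m g}, g ∈ homogeneousSubmodule (Fin (n+1)) K m → φ g = ι (π g) * u ^ m := by
    intro m g hg
    have := aeval_mul_right_of_isHomogeneous (fun i ↦ (ι.comp π) (X i)) u hg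
    rwa [show aeval (fun i ↦ (ι.comp π) (X i)) = ι.comp π from (aeval_unique _).symm] at this
  have hι : Function.Injective ι := by
    refine IsLocalization.injective B (M := Submonoid.powers y) ?_
    rw [Submonoid.powers_le, mem_nonZeroDivisors_iff_right]
    intro z hz
    obtain ⟨g, rfl⟩ := Ideal.Quotient.mk_surjective z
    rw [mul_comm] at hz
    exact Ideal.Quotient.eq_zero_iff_mem.2 (hreg g (Ideal.Quotient.eq_zero_iff_mem.1 hz))
  have hu : ∀ m, Function.Injective (LinearMap.mulRight K (u ^ m)) := by
    intro m a b hab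
    have hab' : a * u ^ m = b * u ^ m := hab
    exact (IsUnit.of_mul_eq_one (ι y) (by rwa [mul_comm])).pow m |>.mul_right_cancel hab'
  refine ⟨B, inferInstance, inferInstance, φ, ?_, ?_, ?_⟩
  · rw [hφ hx, pow_one]
    exact hyu
  · intro g hg
    rw [← sum_homogeneousComponent g, map_sum]
    refine Finset.sum_eq_zero fun m _ ↦ ?_
    rw [hφ (homogeneousComponent_mem m g)]
    have : π (homogeneousComponent m g) = 0 :=
      Ideal.Quotient.eq_zero_iff_mem.2 (homogeneousComponent_mem_of_mem hI hg m)
    rw [this, map_zero, zero_mul]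
  · intro m
    have heq : (homogeneousSubmodule (Fin (n+1)) K m).map φ.toLinearMap =
        ((homogeneousSubmodule (Fin (n+1)) K m).map π.toLinearMap).map
          (LinearMap.mulRight K (u ^ m) ∘ₗ ι.toLinearMap) := by
      ext b
      constructor
      · rintro ⟨g, hg, rfl⟩
        exact ⟨_, ⟨g, hg, rfl⟩, (hφ hg).symm⟩
      · rintro ⟨_, ⟨g, hg, rfl⟩, rfl⟩
        exact ⟨g, hg, hφ hg⟩
    rw [heq]
    exact (Submodule.equivMapOfInjective (LinearMap.mulRight K (u ^ m) ∘ₗ ι.toLinearMap)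
      ((hu m).comp hι) _).finrank_eq.symm

theorem exists_finiteDimensional_algHom_finrank_map_eq_hilbF
    {I : Ideal (MvPolynomial (Fin (n+1)) K)}
    (hI : I.IsHomogeneous (homogeneousSubmodule (Fin (n+1)) K))
    {x : MvPolynomial (Fin (n+1)) K} (hx : x ∈ homogeneousSubmodule (Fin (n+1)) K 1)
    (hreg : ∀ g, x * g ∈ I → g ∈ I) {d : ℕ} (hd : ∀ᶠ m in atTop, hilbF I m = d) :
    ∃ (A : Type) (_ : CommRing A) (_ : Algebra K A) (ψ : MvPolynomial (Fin (n+1)) K →ₐ[K] A),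
      FiniteDimensional K A ∧ finrank K A = d ∧ ψ x = 1 ∧ (∀ g ∈ I, ψ g = 0) ∧
      (∀ m, finrank K ((homogeneousSubmodule (Fin (n+1)) K m).map ψ.toLinearMap) = hilbF I m) ∧
      ∀ᶠ m in atTop, (homogeneousSubmodule (Fin (n+1)) K m).map ψ.toLinearMap = ⊤ := by
  obtain ⟨B, _, _, φ, hφx, hφI, hφ⟩ := exists_algHom_finrank_map_eq_hilbF hI hx hreg
  let S : ℕ → Submodule K B := fun m ↦ (homogeneousSubmodule (Fin (n+1)) K m).map φ.toLinearMap
  have hmono : Monotone S := by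
    refine monotone_nat_of_le_succ fun m ↦ ?_
    rintro _ ⟨g, hg, rfl⟩
    refine ⟨g * x, IsHomogeneous.mul hg hx, ?_⟩
    simp [hφx]
  obtain ⟨M, hM⟩ := eventually_atTop.1 hd
  have hstab : ∀ m, M ≤ m → S m = S M := fun m hm ↦
    (Submodule.eq_of_le_of_finrank_eq (hmono hm)
      (by rw [hφ, hφ, hM m hm, hM M le_rfl])).symm
  have hle : ∀ m, S m ≤ S M := fun m ↦ by
    rcases le_total m M with h | h
    · exact hmono h
    · exact (hstab m h).le
  have hrange : LinearMap.range φ.toLinearMap = S M := by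
    apply le_antisymm
    · rintro _ ⟨g, rfl⟩
      rw [← sum_homogeneousComponent g, map_sum]
      exact Submodule.sum_mem _ fun m _ ↦ hle m ⟨_, homogeneousComponent_mem m g, rfl⟩
    · exact LinearMap.map_le_range
  have hdim : finrank K φ.range = d := by
    change finrank K (LinearMap.range φ.toLinearMap) = d
    rw [hrange, hφ, hM M le_rfl]
  have hfd : FiniteDimensional K φ.range := by
    change FiniteDimensional K (LinearMap.range φ.toLinearMap)
    rw [hrange]
    infer_instance
  have hψ : ∀ m, finrank K
      ((homogeneousSubmodule (Fin (n+1)) K m).map φ.rangeRestrict.toLinearMap) = hilbF I m := by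
    intro m
    rw [← hφ m, (Submodule.equivMapOfInjective φ.range.val.toLinearMap
      Subtype.val_injective _).finrank_eq, ← Submodule.map_comp]
    rfl
  refine ⟨φ.range, inferInstance, inferInstance, φ.rangeRestrict, hfd, hdim,
    Subtype.ext hφx, fun g hg ↦ Subtype.ext (hφI g hg), hψ, ?_⟩
  filter_upwards [hd] with m hm
  exact Submodule.eq_top_of_finrank_eq (by rw [hψ, hm, hdim])

theorem finrank_quotient_span_le_hilbF {I : Ideal (MvPolynomial (Fin (n+1)) K)}
    {x : MvPolynomial (Fin (n+1)) K} (hx : x ∈ homogeneousSubmodule (Fin (n+1)) K 1)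
    {A : Type} [CommRing A] [Algebra K A] {ψ : MvPolynomial (Fin (n+1)) K →ₐ[K] A}
    (hψx : ψ x = 1) (hψI : ∀ g ∈ I, ψ g = 0)
    (W : Submodule K (MvPolynomial (Fin (n+1)) K)) {m : ℕ}
    (hm : (homogeneousSubmodule (Fin (n+1)) K m).map ψ.toLinearMap = ⊤) :
    finrank K (A ⧸ Ideal.span (W.map ψ.toLinearMap : Set A)) ≤
      hilbF (interIdeal I (Ideal.span (W : Set (MvPolynomial (Fin (n+1)) K)))) m := by
  set P := Ideal.span (W.map ψ.toLinearMap : Set A) with hP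
  set J := interIdeal I (Ideal.span (W : Set (MvPolynomial (Fin (n+1)) K))) with hJ
  have hle : I ⊔ Ideal.span (W : Set (MvPolynomial (Fin (n+1)) K)) ≤ P.comap ψ := by
    refine sup_le (fun g hg ↦ ?_) (Ideal.span_le.2 fun w hw ↦ Ideal.subset_span ⟨w, hw, rfl⟩)
    rw [Ideal.mem_comap, hψI g hg]
    exact P.zero_mem
  have hxirr : x ∈ irrelevantIdeal K n := by
    have hx' := hx
    rw [homogeneousSubmodule_one_eq_span_X] at hx'
    exact Submodule.span_le_restrictScalars K _ _ hx'
  have hJP : J ≤ P.comap ψ := by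
    intro g hg
    obtain ⟨k, hk⟩ := mem_saturate_iff.1 hg
    have := hle (hk (x ^ k) (Ideal.pow_mem_pow hxirr k))
    simpa [hψx] using this
  let θ := Ideal.quotientMapₐ P ψ hJP
  have htop : ((homogeneousSubmodule (Fin (n+1)) K m).map
      (Ideal.Quotient.mkₐ K J).toLinearMap).map θ.toLinearMap = ⊤ := by
    have hcomp : θ.toLinearMap ∘ₗ (Ideal.Quotient.mkₐ K J).toLinearMap =
        (Ideal.Quotient.mkₐ K P).toLinearMap ∘ₗ ψ.toLinearMap := rfl
    rw [← Submodule.map_comp, hcomp, Submodule.map_comp, hm, Submodule.map_top,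
      LinearMap.range_eq_top]
    exact Ideal.Quotient.mk_surjective
  rw [hilbF, ← finrank_top K (A ⧸ P), ← htop]
  exact Submodule.finrank_map_le _ _

/-- Castelnuovo's bound for finite schemes in linearly general position. -/
theorem le_hilbF_of_inLinGenPos [IsAlgClosed K] {I : Ideal (MvPolynomial (Fin (n+1)) K)}
    (hfin : IsFiniteSubscheme I) (hlgp : InLinGenPos I) {q : ℕ} (hq : n * q + 1 ≤ schemeDeg I) :
    n * q + 1 ≤ hilbF I q := by
  have : Infinite K := IsAlgClosed.instInfinite
  obtain ⟨d, -, hd⟩ := hfin.finite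
  rw [schemeDeg_eq_of_eventually hd] at hq
  obtain ⟨x, hx, hreg⟩ := exists_linear_form_regular_mod_saturate I
  rw [hfin.saturated] at hreg
  obtain ⟨A, _, _, ψ, _, hA, hψx, hψI, hψ, htop⟩ :=
    exists_finiteDimensional_algHom_finrank_map_eq_hilbF hfin.homog hx hreg hd
  let V := homogeneousSubmodule (Fin (n+1)) K 1
  have hV : finrank K V = n + 1 := by
    rw [show V = Submodule.span K (Set.range X) from homogeneousSubmodule_one_eq_span_X,
      finrank_span_eq_card (linearIndependent_X (Fin (n+1)) K), Fintype.card_fin]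
  let l : V →ₗ[K] A := ψ.toLinearMap ∘ₗ V.subtype
  have hl : LinearMap.range l = V.map ψ.toLinearMap := by
    rw [LinearMap.range_comp, Submodule.range_subtype]
  have hmain := finrank_pow_range_ge K hV q l ⟨⟨x, hx⟩, hψx⟩ (fun W hW1 hWn ↦ ?_)
    (hq.trans_eq hA.symm)
  · refine hmain.trans ?_
    rw [← hψ q, hl]
    refine Submodule.finrank_mono ?_
    rw [← homogeneousSubmodule_one_pow]
    exact (Submodule.map_pow V ψ q).ge
  · have hfr : finrank K (W.map V.subtype) = finrank K W :=
      (Submodule.equivMapOfInjective V.subtype V.subtype_injective W).finrank_eq.symm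
    have hnot : ¬ HasSecantPlane I (n - finrank K W) := by
      refine Nat.notMem_of_lt_sInf (s := {t | HasSecantPlane I t}) ?_
      change _ < tInv I
      rw [show tInv I = n from hlgp]
      omega
    set J := Ideal.span ((W.map V.subtype : Submodule K (MvPolynomial (Fin (n+1)) K)) :
      Set (MvPolynomial (Fin (n+1)) K)) with hJ
    have hdeg : ¬ n - finrank K W + 2 ≤ schemeDeg (interIdeal I J) := fun h ↦
      hnot ⟨J, ⟨W.map V.subtype, Submodule.map_subtype_le _ _, by omega, rfl⟩, h⟩
    have hbound : ∀ m, hilbF (interIdeal I J) m ≤ d := fun m ↦ by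
      refine (hilbF_anti (le_sup_left.trans (le_saturate (I ⊔ J))) m).trans ?_
      rw [← hψ m, ← hA]
      exact Submodule.finrank_le _
    obtain ⟨m, hm1, hm2⟩ :=
      ((hilbF_saturate_eventually_eq_schemeDeg (I ⊔ J) hbound).and htop).exists
    have hle := finrank_quotient_span_le_hilbF hx hψx hψI (W.map V.subtype) hm2
    rw [← Submodule.map_comp] at hle
    change finrank K (A ⧸ Ideal.span (W.map l : Set A)) ≤ hilbF (saturate (I ⊔ J)) m at hle
    change ¬ _ ≤ schemeDeg (saturate (I ⊔ J)) at hdeg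
    omega

end HilbertFunction

/-- Theorem 5.5, the inequality. -/
theorem stmt16 (K : Type) [Field K] [IsAlgClosed K] [CharZero K] (n d q r : ℕ) (hn : 2 ≤ n)
    (I : Ideal (MvPolynomial (Fin (n+1)) K))
    (hfin : IsFiniteSubscheme I) (hlgp : InLinGenPos I) (hdeg : schemeDeg I = d)
    (hd : 4*n^2 + 6*n + 1 ≤ d)
    (hdqr : d = n*q + r + 2) (hr : r ≤ n - 1) :
    h1F I q ≤ r + 1 := by
  have h := le_hilbF_of_inLinGenPos hfin hlgp (q := q) (by omega)
  rw [h1F]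
  omega
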